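/- Let Γ be a torsion-free virtually polycyclic group. Then the center of Γ is trivial if and only if the intersection of all maximal nilpotent subgroups of Γ is the trivial subgroup. -/

import Mathlib

open scoped commutatorElement

theorem aux_comm {G : Type*} [Group G] [h : IsMulCommutative G] : Group.IsNilpotent G :=
  ⟨1, Subgroup.upperCentralSeries_one_eq_top_iff.2 h⟩

open Subgroup in
theorem aux_engel {G : Type*} [Group G] {N : Subgroup G} (hN : Group.IsNilpotent N) {x g : G}
    (hx : x ∈ N) (hg : g ∈ N) : ∃ n : ℕ, (fun y : G => ⁅y, g⁆)^[n] x = 1 := by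
  obtain ⟨n, hn⟩ := (Subgroup.isNilpotent_iff_lowerCentralSeries N).1 hN
  refine ⟨n, ?_⟩
  have key : ∀ k : ℕ, (fun y : G => ⁅y, g⁆)^[k] x ∈ N.lowerCentralSeries k := by
    intro k
    induction k with
    | zero => simpa using hx
    | succ k ih =>
      rw [Function.iterate_succ_apply', Subgroup.lowerCentralSeries_succ]
      exact commutator_mem_commutator ih hg
  have := key n
  rwa [hn, mem_bot] at this

theorem aux_step {G : Type*} [Group G] (B : Subgroup G) (g : G)
    (hB : ∀ b ∈ B, g * b * g⁻¹ ∈ B) (n : ℕ) :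
    ∀ x ∈ B, x ≠ 1 → (fun y : G => ⁅y, g⁆)^[n] x = 1 → ∃ b ∈ B, b ≠ 1 ∧ ⁅b, g⁆ = 1 := by
  induction n with
  | zero => intro x _ h1 h; exact absurd h h1
  | succ n ih =>
    intro x hx h1 h
    by_cases hc : ⁅x, g⁆ = 1
    · exact ⟨x, hx, h1, hc⟩
    · refine ih ⁅x, g⁆ ?_ hc h
      have : ⁅x, g⁆ = x * (g * x * g⁻¹)⁻¹ := by rw [commutatorElement_def]; group
      rw [this]
      exact B.mul_mem hx (B.inv_mem (hB x hx))

theorem aux_kolchin {G : Type*} [Group G] (I K L : Subgroup G) (hI : I.Normal)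
    (hU : ∀ x ∈ I, ∀ g : G, ∃ n : ℕ, (fun y : G => ⁅y, g⁆)^[n] x = 1)
    (hKL : K ≤ L) (hLL : ⁅L, L⁆ ≤ K) (hL : L.FG)
    (h : ∃ b ∈ I, b ≠ 1 ∧ ∀ k ∈ K, Commute k b) : ∃ b ∈ I, b ≠ 1 ∧ ∀ k ∈ L, Commute k b := by
  classical
  obtain ⟨S, hS⟩ := hL
  have key : ∀ T : Finset G, (∀ t ∈ T, t ∈ L) →
      ∃ b ∈ I, b ≠ 1 ∧ (∀ k ∈ K, Commute k b) ∧ ∀ t ∈ T, Commute t b := by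
    intro T
    induction T using Finset.induction_on with
    | empty => intro _; obtain ⟨b, h1, h2, h3⟩ := h; exact ⟨b, h1, h2, h3, by simp⟩
    | insert g T _ ih =>
      intro hT
      obtain ⟨b, hb, hb1, hbK, hbT⟩ := ih (fun t ht => hT t (Finset.mem_insert_of_mem ht))
      have hg : g ∈ L := hT g (Finset.mem_insert_self _ _)
      let B : Subgroup G := I ⊓ (Subgroup.centralizer (K : Set G) ⊓ Subgroup.centralizer (T : Set G))
      have memB : ∀ x, x ∈ B ↔ x ∈ I ∧ (∀ k ∈ K, k * x = x * k) ∧ ∀ t ∈ T, t * x = x * t := by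
        intro x
        simp [B, Subgroup.mem_inf, Subgroup.mem_centralizer_iff]
      have conjc : ∀ l ∈ L, ∀ x : G, (∀ k ∈ K, k * x = x * k) → l * x = x * l →
          l * (g * x * g⁻¹) = (g * x * g⁻¹) * l := by
        intro l hl x hxK hlx
        have hc : ⁅l⁻¹, g⁻¹⁆ ∈ K := hLL (Subgroup.commutator_mem_commutator (L.inv_mem hl) (L.inv_mem hg))
        have e : g⁻¹ * l * g = l * ⁅l⁻¹, g⁻¹⁆ := by rw [commutatorElement_def]; group
        have e2 : (g⁻¹ * l * g) * x = x * (g⁻¹ * l * g) := by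
          rw [e, mul_assoc, hxK _ hc, ← mul_assoc, hlx, mul_assoc]
        calc l * (g * x * g⁻¹) = g * ((g⁻¹ * l * g) * x) * g⁻¹ := by group
          _ = g * (x * (g⁻¹ * l * g)) * g⁻¹ := by rw [e2]
          _ = _ := by group
      have hBg : ∀ b ∈ B, g * b * g⁻¹ ∈ B := by
        intro x hx
        obtain ⟨h1, h2, h3⟩ := (memB x).1 hx
        refine (memB _).2 ⟨hI.conj_mem _ h1 _, fun k hk => conjc k (hKL hk) x h2 (h2 k hk), ?_⟩
        exact fun t ht => conjc t (hT t (Finset.mem_insert_of_mem ht)) x h2 (h3 t ht)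
      obtain ⟨n, hn⟩ := hU b hb g
      obtain ⟨c, hc, hc1, hcg⟩ := aux_step B g hBg n b ((memB b).2 ⟨hb, hbK, hbT⟩) hb1 hn
      obtain ⟨h1, h2, h3⟩ := (memB c).1 hc
      refine ⟨c, h1, hc1, h2, ?_⟩
      intro t ht
      rcases Finset.mem_insert.1 ht with rfl | ht
      · exact (commutatorElement_eq_one_iff_mul_comm.1 hcg).symm
      · exact h3 t ht
  obtain ⟨b, hb, hb1, -, hbS⟩ := key S (fun t ht => hS ▸ Subgroup.subset_closure ht)
  refine ⟨b, hb, hb1, ?_⟩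
  have : L ≤ Subgroup.centralizer {b} := by
    rw [← hS, Subgroup.closure_le]
    intro t ht
    rw [SetLike.mem_coe, Subgroup.mem_centralizer_singleton_iff]
    exact (hbS t ht)
  intro k hk
  exact Subgroup.mem_centralizer_singleton_iff.1 (this hk)

theorem aux_fin {G : Type*} [Group G] (htf : ∀ g : G, g ≠ 1 → ¬IsOfFinOrder g)
    (B : Subgroup G) (g : G) (m : ℕ) (hm : 0 < m)
    (hB : ∀ b ∈ B, g * b * g⁻¹ ∈ B) (hgm : ∀ b ∈ B, Commute (g ^ m) b) (n : ℕ) :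
    ∀ x ∈ B, (fun y : G => ⁅y, g⁆)^[n] x = 1 → ⁅x, g⁆ = 1 := by
  induction n with
  | zero => intro x _ h; have : x = 1 := h; simp [this]
  | succ n ih =>
    intro x hx h
    have hc : ⁅⁅x, g⁆, g⁆ = 1 := by
      refine ih ⁅x, g⁆ ?_ h
      have : ⁅x, g⁆ = x * (g * x * g⁻¹)⁻¹ := by rw [commutatorElement_def]; group
      rw [this]
      exact B.mul_mem hx (B.inv_mem (hB x hx))
    have hcg : Commute ⁅x, g⁆ g := commutatorElement_eq_one_iff_mul_comm.1 hc
    have hxg : x * g * x⁻¹ = ⁅x, g⁆ * g := by rw [commutatorElement_def]; group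
    have h1 : x * g ^ m * x⁻¹ = ⁅x, g⁆ ^ m * g ^ m := by
      rw [← conj_pow, hxg, hcg.mul_pow]
    have h2 : x * g ^ m * x⁻¹ = g ^ m := by
      rw [← (hgm x hx).eq]; group
    rw [h2] at h1
    have h3 : ⁅x, g⁆ ^ m = 1 := by simpa using h1.symm
    by_contra hne
    exact htf _ hne (isOfFinOrder_iff_pow_eq_one.2 ⟨m, hm, h3⟩)

theorem aux_fg {G : Type*} [Group G] (H : Subgroup G) (hH : H.FiniteIndex)
    (hfg : ∀ K : Subgroup H, K.FG) (K : Subgroup G) : K.FG := by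
  classical
  have h1 : (K ⊓ H).FG := by
    obtain ⟨S, hS⟩ := hfg (K.subgroupOf H)
    refine ⟨S.image H.subtype, ?_⟩
    rw [Finset.coe_image, ← MonoidHom.map_closure, hS, Subgroup.subgroupOf_map_subtype]
  obtain ⟨S, hS⟩ := h1
  -- choose representatives
  have : Finite (G ⧸ H) := inferInstance
  let r : G ⧸ H → G := fun q => if h : ∃ k ∈ K, (QuotientGroup.mk k : G ⧸ H) = q then h.choose else 1
  have hrK : ∀ q, r q ∈ K := by
    intro q
    by_cases h : ∃ k ∈ K, (QuotientGroup.mk k : G ⧸ H) = q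
    · simp only [r, dif_pos h]; exact h.choose_spec.1
    · simp only [r, dif_neg h]; exact K.one_mem
  have hr : ∀ k ∈ K, (QuotientGroup.mk (r (QuotientGroup.mk k)) : G ⧸ H) = QuotientGroup.mk k := by
    intro k hk
    have h : ∃ k' ∈ K, (QuotientGroup.mk k' : G ⧸ H) = QuotientGroup.mk k := ⟨k, hk, rfl⟩
    simp only [r, dif_pos h]; exact h.choose_spec.2
  rw [Subgroup.fg_iff]
  refine ⟨(S : Set G) ∪ Set.range r, le_antisymm ?_ ?_, S.finite_toSet.union (Set.finite_range r)⟩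
  · rw [Subgroup.closure_le]
    rintro x (hx | ⟨q, rfl⟩)
    · have : x ∈ K ⊓ H := hS ▸ Subgroup.subset_closure hx
      exact this.1
    · exact hrK q
  · intro k hk
    have h2 : (r (QuotientGroup.mk k))⁻¹ * k ∈ K ⊓ H :=
      ⟨K.mul_mem (K.inv_mem (hrK _)) hk, QuotientGroup.eq.1 (hr k hk)⟩
    rw [← hS] at h2
    have h3 := Subgroup.closure_mono (Set.subset_union_left (t := Set.range r)) h2
    have h4 : r (QuotientGroup.mk k) ∈ Subgroup.closure ((S : Set G) ∪ Set.range r) :=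
      Subgroup.subset_closure (Or.inr ⟨_, rfl⟩)
    simpa using Subgroup.mul_mem _ h4 h3

theorem aux_max {G : Type*} [Group G] (hfg : ∀ K : Subgroup G, K.FG) (P : Subgroup G)
    (hP : Group.IsNilpotent P) : ∃ N : Subgroup G, P ≤ N ∧ Group.IsNilpotent N ∧
      ∀ K : Subgroup G, Group.IsNilpotent ↥K → N ≤ K → K = N := by
  obtain ⟨m, hPm, hm⟩ := zorn_le_nonempty₀ {N : Subgroup G | Group.IsNilpotent N} (by
    intro c hc hch y hy
    obtain ⟨S, hS⟩ := hfg (sSup c)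
    have key : ∀ T : Finset G, (∀ t ∈ T, t ∈ sSup c) → ∃ N ∈ c, ∀ t ∈ T, t ∈ N := by
      classical
      intro T
      induction T using Finset.induction_on with
      | empty => intro _; exact ⟨y, hy, by simp⟩
      | insert g T _ ih =>
        intro hT
        obtain ⟨N, hN, hNT⟩ := ih (fun t ht => hT t (Finset.mem_insert_of_mem ht))
        obtain ⟨M, hM, hgM⟩ := (Subgroup.mem_sSup_of_directedOn ⟨y, hy⟩ hch.directedOn).1
          (hT g (Finset.mem_insert_self _ _))
        rcases hch.total hN hM with h | h
        · refine ⟨M, hM, fun t ht => ?_⟩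
          rcases Finset.mem_insert.1 ht with rfl | ht
          · exact hgM
          · exact h (hNT t ht)
        · refine ⟨N, hN, fun t ht => ?_⟩
          rcases Finset.mem_insert.1 ht with rfl | ht
          · exact h hgM
          · exact hNT t ht
    obtain ⟨N, hN, hSN⟩ := key S (fun t ht => hS ▸ Subgroup.subset_closure ht)
    refine ⟨N, hc hN, fun z hz => (le_sSup hz).trans ?_⟩
    rw [← hS, Subgroup.closure_le]
    exact hSN) P hP
  exact ⟨m, hPm, hm.prop, fun K hK h => le_antisymm (hm.le_of_ge hK h) h⟩

theorem aux_normal {G : Type*} [Group G] :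
    (sInf {N : Subgroup G | Group.IsNilpotent ↥N ∧
        ∀ K : Subgroup G, Group.IsNilpotent ↥K → N ≤ K → K = N}).Normal := by
  have hmap : ∀ (N : Subgroup G) (g : G), Group.IsNilpotent N →
      Group.IsNilpotent (N.map (MulAut.conj g).toMonoidHom) := by
    intro N g hN
    exact Group.nilpotent_of_mulEquiv
      (N.equivMapOfInjective (MulAut.conj g).toMonoidHom (MulAut.conj g).injective)
  have hmm : ∀ (N : Subgroup G) (g : G),
      (N.map (MulAut.conj g⁻¹).toMonoidHom).map (MulAut.conj g).toMonoidHom = N := by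
    intro N g
    ext x
    simp [Subgroup.mem_map, mul_assoc]
  refine ⟨fun x hx g => ?_⟩
  rw [Subgroup.mem_sInf] at hx ⊢
  rintro N ⟨hN, hmax⟩
  have := hx (N.map (MulAut.conj g⁻¹).toMonoidHom) ⟨hmap N _ hN, fun K hK hle => ?_⟩
  · have h2 := Subgroup.mem_map_of_mem (MulAut.conj g).toMonoidHom this
    rw [hmm] at h2
    simpa using h2
  · have h3 := hmax _ (hmap K g hK) (by
      have := Subgroup.map_mono (f := (MulAut.conj g).toMonoidHom) hle
      rwa [hmm] at this)
    rw [← h3]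
    have := hmm K g⁻¹
    rw [inv_inv] at this
    exact this.symm

theorem aux_center {G : Type*} [Group G] :
    Subgroup.center G ≤ sInf {N : Subgroup G | Group.IsNilpotent ↥N ∧
        ∀ K : Subgroup G, Group.IsNilpotent ↥K → N ≤ K → K = N} := by
  refine le_sInf ?_
  rintro N ⟨hN, hmax⟩
  let f : N × Subgroup.center G →* G := MonoidHom.noncommCoprod N.subtype
    (Subgroup.center G).subtype (fun n z => Subgroup.mem_center_iff.1 z.2 n)
  have hf : f.range = N ⊔ Subgroup.center G := by
    refine (MonoidHom.noncommCoprod_range _ _ _).trans ?_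
    simp
  have hZn : Group.IsNilpotent (Subgroup.center G) := aux_comm
  have h1 : Group.IsNilpotent f.range :=
    Group.nilpotent_of_surjective f.rangeRestrict f.rangeRestrict_surjective
  rw [hf] at h1
  rw [← hmax _ h1 le_sup_left]
  exact le_sup_right

/-- For a torsion-free virtually polycyclic group Γ, the center is trivial iff
the intersection of all maximal nilpotent subgroups is trivial. -/
theorem center_trivial_iff_sInf_maximal_nilpotent_trivial
    {Γ : Type*} [Group Γ]
    (htf : ∀ g : Γ, g ≠ 1 → ¬IsOfFinOrder g)
    (hvp : ∃ H : Subgroup Γ, H.FiniteIndex ∧ IsSolvable ↥H ∧ ∀ K : Subgroup ↥H, K.FG) :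
    Subgroup.center Γ = ⊥ ↔
      sInf {N : Subgroup Γ | Group.IsNilpotent ↥N ∧
        ∀ K : Subgroup Γ, Group.IsNilpotent ↥K → N ≤ K → K = N} = ⊥ := by
  constructor
  swap
  · intro h
    exact le_bot_iff.1 (h ▸ aux_center)
  intro hZ
  obtain ⟨H, hHi, hHs, hHf⟩ := hvp
  have hfg := aux_fg H hHi hHf
  have hIn := aux_normal (G := Γ)
  set I := sInf {N : Subgroup Γ | Group.IsNilpotent ↥N ∧
        ∀ K : Subgroup Γ, Group.IsNilpotent ↥K → N ≤ K → K = N} with hIdef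
  have hU : ∀ x ∈ I, ∀ g : Γ, ∃ n : ℕ, (fun y : Γ => ⁅y, g⁆)^[n] x = 1 := by
    intro x hx g
    obtain ⟨N, hgN, hN, hmax⟩ := aux_max hfg (Subgroup.zpowers g)
      aux_comm
    exact aux_engel hN ((sInf_le (show N ∈ _ from ⟨hN, hmax⟩) : I ≤ N) hx)
      (hgN (Subgroup.mem_zpowers g))
  by_contra hI
  obtain ⟨b, hb, hb1⟩ := Subgroup.ne_bot_iff_exists_ne_one.1 hI |>.elim
    (fun a ha => (⟨a.1, a.2, fun h => ha (Subtype.ext h)⟩ : ∃ b ∈ I, b ≠ 1))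
  let M := H.normalCore
  have hHs' : Group.IsSolvable H := hHs
  have hMs : Group.IsSolvable M := Group.isSolvable_of_isSolvable_injective
    (f := Subgroup.inclusion H.normalCore_le) (Subgroup.inclusion_injective _)
  obtain ⟨n, hn⟩ := hMs.solvable
  have key : ∀ j k, j + k = n → ∃ b ∈ I, b ≠ 1 ∧
      ∀ c ∈ (derivedSeries M k).map M.subtype, Commute c b := by
    intro j
    induction j with
    | zero =>
      intro k hk
      have : k = n := by omega
      subst this
      refine ⟨b, hb, hb1, ?_⟩
      rw [hn]
      simp
    | succ j ih =>
      intro k hk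
      refine aux_kolchin I _ _ hIn hU (Subgroup.map_mono (derivedSeries_antitone M (Nat.le_succ k)))
        ?_ (hfg _) (ih (k + 1) (by omega))
      rw [derivedSeries_succ, Subgroup.map_commutator]
  obtain ⟨a, ha, ha1, haM⟩ := key n 0 (by simp)
  have haM' : ∀ c ∈ M, Commute c a := by
    intro c hc
    exact haM c ⟨⟨c, hc⟩, by simp, rfl⟩
  have hMn : M.Normal := H.normalCore_normal
  let B : Subgroup Γ := I ⊓ Subgroup.centralizer (M : Set Γ)
  have hBn : B.Normal := inferInstance
  have haB : a ∈ B := ⟨ha, Subgroup.mem_centralizer_iff.2 fun c hc => haM' c hc⟩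
  have haZ : a ∈ Subgroup.center Γ := by
    rw [Subgroup.mem_center_iff]
    intro g
    have hMi : M.index ≠ 0 := Subgroup.FiniteIndex.index_ne_zero
    obtain ⟨m, hm, -, hgm⟩ := Subgroup.exists_pow_mem_of_index_ne_zero hMi g
    obtain ⟨l, hl⟩ := hU a ha g
    have := aux_fin htf B g m hm (fun b hb => hBn.conj_mem b hb g)
      (fun b hb => Subgroup.mem_centralizer_iff.1 hb.2 _ hgm) l a haB hl
    exact (commutatorElement_eq_one_iff_mul_comm.1 this).symm
  rw [hZ, Subgroup.mem_bot] at haZ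
  exact ha1 haZ
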